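/- Assume d ≥ 5. One has |E[Cap(R_n)] − γ_d n| = O(ψ_d(n)), where ψ_d(n) = √n if d = 5, ψ_d(n) = log n if d = 6, and ψ_d(n) = 1 if d ≥ 7, and where γ_d := lim_n Cap(R_n)/n. -/

import Mathlib

open Filter Finset MeasureTheory
open scoped symmDiff ENNReal

namespace SRW

/-- Vertices of `ℤ^d`. -/
abbrev V (d : ℕ) : Type := Fin d → ℤ

/-- The set of nearest-neighbor steps (the `2d` unit vectors `±e_i`) in `ℤ^d`. -/
def steps (d : ℕ) : Finset (V d) :=
  (Finset.univ : Finset (Fin d × Bool)).image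
    (fun p j => if j = p.1 then (if p.2 then 1 else -1) else 0)

/-- Position at time `k` of the walk started at `x` with step sequence `s`. -/
def pos {d : ℕ} (x : V d) (s : ℕ → V d) (k : ℕ) : V d :=
  x + ∑ i ∈ Finset.range k, s i

open Classical in
/-- Probability, for the simple random walk, of an event depending on the
first `n` steps (steps beyond `n` are set to `0`): each of the `(2d)^n`
admissible step sequences has equal probability. -/
noncomputable def probN (d n : ℕ) (P : (ℕ → V d) → Prop) : ℝ :=
  (((Fintype.piFinset fun _ : Fin n => steps d).filter
      (fun s => P fun i => if h : i < n then s ⟨i, h⟩ else 0)).card : ℝ) / ((2 * d : ℕ) : ℝ) ^ n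

/-- Expectation of a functional of the first `n` steps of the walk. -/
noncomputable def expN (d n : ℕ) (f : (ℕ → V d) → ℝ) : ℝ :=
  (∑ s ∈ Fintype.piFinset fun _ : Fin n => steps d,
      f fun i => if h : i < n then s ⟨i, h⟩ else 0) / ((2 * d : ℕ) : ℝ) ^ n

/-- Escape probability `P_x(H_A^+ = ∞)`: the walk started at `x` never
hits `A` at a positive time (decreasing limit of the finite-horizon events). -/
noncomputable def esc (d : ℕ) (A : Set (V d)) (x : V d) : ℝ :=
  ⨅ n : ℕ, probN d n (fun s => ∀ k, 1 ≤ k → k ≤ n → pos x s k ∉ A)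

/-- Newtonian capacity `Cap(A) = Σ_{x∈A} P_x(H_A^+ = ∞)`. -/
noncomputable def cap {d : ℕ} (A : Finset (V d)) : ℝ :=
  ∑ x ∈ A, esc d (↑A) x

/-- Green's function `G(z) = Σ_n P_0(S_n = z)`. -/
noncomputable def G (d : ℕ) (z : V d) : ℝ :=
  ∑' n : ℕ, probN d n (fun s => pos 0 s n = z)

/-- Truncated Green's function `G_T(z) = Σ_{n≤T} P_0(S_n = z)`. -/
noncomputable def GT (d T : ℕ) (z : V d) : ℝ :=
  ∑ n ∈ Finset.range (T + 1), probN d n (fun s => pos 0 s n = z)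

/-- Convolution `(G ⋆ G_T)(x) = Σ_y G(x-y) G_T(y)`. -/
noncomputable def GconvGT (d T : ℕ) (x : V d) : ℝ :=
  ∑' y : V d, G d (x - y) * GT d T y

/-- Euclidean norm on `ℤ^d`. -/
noncomputable def nrm {d : ℕ} (x : V d) : ℝ :=
  Real.sqrt (∑ i, ((x i : ℝ)) ^ 2)

/-- The range `{S_k : k ∈ I}` of the walk started at `x` over the set of times `I`. -/
noncomputable def rangeOn {d : ℕ} (x : V d) (s : ℕ → V d) (I : Finset ℕ) : Finset (V d) :=
  I.image (pos x s)

/-- Probability that the walk started at `z` hits both `A` and `B` in finite time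
(increasing limit of the finite-horizon probabilities). -/
noncomputable def hitBothProb (d : ℕ) (A B : Finset (V d)) (z : V d) : ℝ :=
  ⨆ n : ℕ, probN d n (fun s => (∃ k ≤ n, pos z s k ∈ A) ∧ (∃ k ≤ n, pos z s k ∈ B))

/-- The discrete cube `Q(x,r) = [x - r/2, x + r/2)^d ∩ ℤ^d`. -/
def cube {d : ℕ} (x : V d) (r : ℝ) : Set (V d) :=
  {y | ∀ i, (x i : ℝ) - r / 2 ≤ (y i : ℝ) ∧ (y i : ℝ) < (x i : ℝ) + r / 2}

/-- The corrector `ξ_n(T)`. -/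
noncomputable def xi (d n T : ℕ) (s : ℕ → V d) : ℝ :=
  ∑ k ∈ Finset.range (n + 1), ∑ x ∈ rangeOn 0 s (Finset.Icc 0 k),
    esc d (↑(rangeOn 0 s (Finset.Icc 0 k))) x * (GconvGT d T (x - pos 0 s k) / T)

/-- The capacity cross-term `χ_C(A,B) = Cap(A) + Cap(B) - Cap(A ∪ B)`. -/
noncomputable def chiC {d : ℕ} (A B : Finset (V d)) : ℝ := cap A + cap B - cap (A ∪ B)

open Classical in
/-- Conditional expectation, given the first `m` steps (equal to those of `s`),
of a functional of the first `n` steps. -/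
noncomputable def condExpN (d n m : ℕ) (f : (ℕ → V d) → ℝ) (s : ℕ → V d) : ℝ :=
  expN d n (fun s' => if ∀ i < m, s' i = s i then f s' else 0) * ((2 * d : ℕ) : ℝ) ^ m

/-- The compensator `ξ_n^*(T)`. -/
noncomputable def xiStar (d n T : ℕ) (s : ℕ → V d) : ℝ :=
  (1 / (T : ℝ)) * ∑ j ∈ Finset.range T, ∑ l ∈ Finset.Icc 1 (n / T - 1),
    condExpN d (n + T) (j + l * T)
      (fun s' => chiC (rangeOn 0 s' (Finset.Icc j (j + l * T)))
        (rangeOn 0 s' (Finset.Icc (j + l * T) (j + (l + 1) * T)))) s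

/-- `E[Cap(R_n)]`, the expected capacity of the range up to time `n`. -/
noncomputable def expCapRange (d n : ℕ) : ℝ :=
  expN d n (fun s => cap (rangeOn 0 s (Finset.Icc 0 n)))

/-- The maximal capacity `c_n` of the range of a nearest-neighbor path with `n` steps. -/
noncomputable def maxPathCap (d n : ℕ) : ℝ :=
  sSup {y : ℝ | ∃ (x : V d) (s : ℕ → V d), (∀ i, s i ∈ steps d) ∧
    y = cap (rangeOn x s (Finset.Icc 0 n))}

/-- `Γ(A,Λ) = Σ_{x∈A} Σ_{y∈Λ} G(y-x) P_y(H_Λ^+ = ∞)`. -/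
noncomputable def GamFin (d : ℕ) (A : Finset (V d)) (Λ : Set (V d)) : ℝ :=
  ∑ x ∈ A, ∑' y : Λ, G d ((y : V d) - x) * esc d Λ (y : V d)

/-- `P(Γ(R̃_∞, Λ) > t)`, as the increasing limit of the finite-horizon probabilities. -/
noncomputable def PGam (d : ℕ) (Λ : Set (V d)) (t : ℝ) : ℝ :=
  ⨆ N : ℕ, probN d N (fun s => t < GamFin d (rangeOn 0 s (Finset.Icc 0 N)) Λ)

/-- `E_x[Γ(R̃_∞, Λ)]`, as the increasing limit of the finite-horizon expectations. -/
noncomputable def EGam (d : ℕ) (x : V d) (Λ : Set (V d)) : ℝ :=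
  ⨆ N : ℕ, expN d N (fun s => GamFin d (rangeOn x s (Finset.Icc 0 N)) Λ)

/-- The law of the first `n` steps of two independent simple random walks:
uniform measure on pairs of admissible step sequences of length `n`. -/
noncomputable def pairLevel (d n : ℕ) : Measure ((Fin n → V d) × (Fin n → V d)) :=
  (((2 * d : ℕ) : ℝ≥0∞) ^ (2 * n))⁻¹ •
    ∑ a ∈ Fintype.piFinset fun _ : Fin n => steps d,
      ∑ b ∈ Fintype.piFinset fun _ : Fin n => steps d, Measure.dirac (a, b)

open Classical in
/-- `Γ(R̃_∞, R_∞) = Σ_{x ∈ R̃_∞} Σ_{y ∈ R_∞} G(y-x) P_y(H_{R_∞}^+ = ∞)` for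
two (step sequences of) walks, with values in `ℝ≥0∞`. -/
noncomputable def gammaInf (d : ℕ) (sA sB : ℕ → V d) : ℝ≥0∞ :=
  ∑' x : V d, ∑' y : V d,
    if x ∈ Set.range (pos (0 : V d) sA) ∧ y ∈ Set.range (pos (0 : V d) sB) then
      ENNReal.ofReal (G d (y - x) * esc d (Set.range (pos (0 : V d) sB)) y)
    else 0

/-- The path following `s` for `m` steps and then `s'`. -/
def concat {d : ℕ} (m : ℕ) (s s' : ℕ → V d) : ℕ → V d :=
  fun i => if i < m then s i else s' (i - m)

/-- A finite sequence of steps, extended by `0`. -/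
def extend {d n : ℕ} (s : Fin n → V d) : ℕ → V d :=
  fun i => if h : i < n then s ⟨i, h⟩ else 0

theorem expN_eq (d n : ℕ) (f : (ℕ → V d) → ℝ) :
    expN d n f = (∑ s ∈ Fintype.piFinset fun _ : Fin n => steps d, f (extend s)) /
      ((2 * d : ℕ) : ℝ) ^ n := rfl

theorem step_injective (d : ℕ) : Function.Injective
    (fun (p : Fin d × Bool) (j : Fin d) =>
      if j = p.1 then (if p.2 then (1 : ℤ) else -1) else 0) := by
  rintro ⟨i, b⟩ ⟨j, c⟩ h
  have h1 := congrFun h i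
  by_cases hij : i = j
  · subst hij
    cases b <;> cases c <;> simp_all
  · cases b <;> simp [hij] at h1

theorem card_steps (d : ℕ) : (steps d).card = 2 * d := by
  rw [steps, Finset.card_image_of_injective _ (step_injective d)]
  simp [mul_comm]

theorem sum_steps {M : Type*} [AddCommMonoid M] (d : ℕ) (f : V d → M) :
    ∑ e ∈ steps d, f e = ∑ i, (f (Pi.single i 1) + f (Pi.single i (-1))) := by
  rw [steps, Finset.sum_image (fun _ _ _ _ h => step_injective d h), Fintype.sum_prod_type]
  refine Finset.sum_congr rfl fun i _ => ?_
  simp only [Fintype.sum_bool, if_true]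
  congr 2 <;> ext j <;> simp [Pi.single_apply]

theorem neg_mem_steps {d : ℕ} {x : V d} (hx : x ∈ steps d) : -x ∈ steps d := by
  simp only [steps, Finset.mem_image, Finset.mem_univ, true_and, Prod.exists] at hx ⊢
  obtain ⟨i, b, rfl⟩ := hx
  refine ⟨i, !b, ?_⟩
  ext j
  by_cases h : j = i <;> cases b <;> simp [h]

section Expectation

variable {d : ℕ}

theorem expN_const (hd : 0 < d) (n : ℕ) (c : ℝ) : expN d n (fun _ => c) = c := by
  have : ((2 * d : ℕ) : ℝ) ^ n ≠ 0 := by positivity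
  simp only [expN, Finset.sum_const, Fintype.card_piFinset_const, card_steps, nsmul_eq_mul]
  push_cast at this ⊢
  field_simp

theorem expN_mono (n : ℕ) {f g : (ℕ → V d) → ℝ} (h : ∀ s, f s ≤ g s) :
    expN d n f ≤ expN d n g := by
  simp only [expN]
  gcongr
  apply h

theorem expN_add_fun (n : ℕ) (f g : (ℕ → V d) → ℝ) :
    expN d n (fun s => f s + g s) = expN d n f + expN d n g := by
  simp only [expN, Finset.sum_add_distrib, add_div]

theorem expN_sum {ι : Type*} (n : ℕ) (I : Finset ι) (f : ι → (ℕ → V d) → ℝ) :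
    expN d n (fun s => ∑ i ∈ I, f i s) = ∑ i ∈ I, expN d n (f i) := by
  simp only [expN]
  rw [Finset.sum_comm, Finset.sum_div]

theorem expN_tsum (n : ℕ) (f : ℕ → (ℕ → V d) → ℝ) (hf : ∀ s, Summable fun t => f t s) :
    expN d n (fun s => ∑' t, f t s) = ∑' t, expN d n (f t) := by
  simp only [expN]
  rw [← Summable.tsum_finsetSum (fun s _ => hf _), tsum_div_const]

theorem extend_append {m n : ℕ} (a : Fin m → V d) (b : Fin n → V d) :
    extend (Fin.append a b) = concat m (extend a) (extend b) := by
  ext1 i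
  simp only [extend, concat]
  by_cases h : i < m
  · have : i < m + n := by omega
    simp only [h, this, dif_pos, if_true]
    exact Fin.append_left a b ⟨i, h⟩
  · by_cases h2 : i < m + n
    · have h3 : i - m < n := by omega
      simp only [h, h2, h3, dif_pos, if_false]
      have := Fin.append_right a b ⟨i - m, h3⟩
      rw [← this]
      congr 1
      ext
      simp
      omega
    · have h3 : ¬ i - m < n := by omega
      simp [h, h2, h3]

/-- The Markov property at the deterministic time `m`. -/
theorem expN_add (m n : ℕ) (f : (ℕ → V d) → ℝ) :
    expN d (m + n) f = expN d m (fun s => expN d n (fun s' => f (concat m s s'))) := by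
  simp only [expN_eq]
  rw [← Finset.sum_div, div_div, ← pow_add, add_comm n m, ← Finset.sum_product']
  congr 1
  symm
  refine Finset.sum_equiv (Fin.appendEquiv m n) ?_ ?_
  · rintro ⟨a, b⟩
    simp only [Finset.mem_product, Fintype.mem_piFinset, Fin.appendEquiv, Equiv.coe_fn_mk]
    constructor
    · rintro ⟨ha, hb⟩ i
      refine Fin.addCases (fun i => ?_) (fun i => ?_) i
      · simpa using ha i
      · simpa using hb i
    · intro h
      exact ⟨fun i => by simpa using h (Fin.castAdd n i), fun i => by simpa using h (Fin.natAdd m i)⟩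
  · rintro ⟨a, b⟩ -
    simp [Fin.appendEquiv, extend_append]

theorem expN_neg (n : ℕ) (f : (ℕ → V d) → ℝ) :
    expN d n (fun s => f (-s)) = expN d n f := by
  simp only [expN_eq]
  congr 1
  refine Finset.sum_equiv (Equiv.neg _) ?_ ?_
  · intro a
    simp only [Fintype.mem_piFinset, Equiv.neg_apply, Pi.neg_apply]
    exact ⟨fun h i => neg_mem_steps (h i), fun h i => by simpa using neg_mem_steps (h i)⟩
  · intro a _
    congr 1
    ext1 i
    by_cases h : i < n <;> simp [extend, h]

theorem expN_concat_left (hd : 0 < d) (m n : ℕ) {f g : (ℕ → V d) → ℝ}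
    (h : ∀ s s', f (concat m s s') = g s) : expN d (m + n) f = expN d m g := by
  simp only [expN_add, h, expN_const hd]

theorem expN_concat_right (hd : 0 < d) (m n : ℕ) {f g : (ℕ → V d) → ℝ}
    (h : ∀ s s', f (concat m s s') = g s') : expN d (m + n) f = expN d n g := by
  simp only [expN_add, h, expN_const hd]

theorem probN_eq_expN (n : ℕ) (P : (ℕ → V d) → Prop) [DecidablePred P] :
    probN d n P = expN d n (fun s => if P s then 1 else 0) := by
  simp only [probN, expN, Finset.sum_boole]
  congr

theorem pos_concat_of_le (x : V d) {m k : ℕ} (h : k ≤ m) (s s' : ℕ → V d) :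
    pos x (concat m s s') k = pos x s k := by
  simp only [pos]
  congr 1
  refine Finset.sum_congr rfl fun i hi => ?_
  have : i < m := by have := Finset.mem_range.1 hi; omega
  simp [concat, this]

theorem pos_concat_add (x : V d) (m k : ℕ) (s s' : ℕ → V d) :
    pos x (concat m s s') (m + k) = pos x s m + pos 0 s' k := by
  simp only [pos, Finset.sum_range_add, zero_add, ← add_assoc]
  congr 1
  · congr 1
    refine Finset.sum_congr rfl fun i hi => ?_
    simp [concat, Finset.mem_range.1 hi]
  · simp [concat]

theorem pos_neg (s : ℕ → V d) (k : ℕ) : pos 0 (-s) k = -pos 0 s k := by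
  simp [pos]

theorem pos_eq_add (x : V d) (s : ℕ → V d) (k : ℕ) : pos x s k = x + pos 0 s k := by
  simp [pos]

end Expectation

section HeatKernel

open Real Complex

variable {d : ℕ}

/-- The transition probability `P_0(S_n = z)`. -/
noncomputable def heatKernel (d n : ℕ) (z : V d) : ℝ :=
  probN d n (fun s => pos 0 s n = z)

/-- Lebesgue measure on the torus `(-π, π]^d`. -/
noncomputable def torusMeasure (d : ℕ) : Measure (Fin d → ℝ) :=
  Measure.pi fun _ => volume.restrict (Set.Ioc (-π) π)

instance : IsFiniteMeasure (torusMeasure d) := by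
  unfold torusMeasure
  infer_instance

/-- The character `θ ↦ exp(i θ·x)`. -/
noncomputable def character (x : V d) (θ : Fin d → ℝ) : ℂ :=
  ∏ j, Complex.exp (I * x j * θ j)

theorem continuous_character (x : V d) : Continuous (character x) := by
  unfold character
  fun_prop

theorem norm_character (x : V d) (θ : Fin d → ℝ) : ‖character x θ‖ = 1 := by
  simp [character, Complex.norm_exp]

theorem character_add (x y : V d) (θ : Fin d → ℝ) :
    character (x + y) θ = character x θ * character y θ := by
  simp only [character, ← Finset.prod_mul_distrib, ← Complex.exp_add]
  refine Finset.prod_congr rfl fun j _ => ?_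
  congr 1
  simp only [Pi.add_apply]
  push_cast
  ring

theorem character_sum {ι : Type*} (I : Finset ι) (x : ι → V d) (θ : Fin d → ℝ) :
    character (∑ i ∈ I, x i) θ = ∏ i ∈ I, character (x i) θ := by
  classical
  induction I using Finset.induction_on with
  | empty => simp [character]
  | insert a I ha ih => rw [Finset.sum_insert ha, Finset.prod_insert ha, character_add, ih]

theorem character_single (i : Fin d) (a : ℤ) (θ : Fin d → ℝ) :
    character (Pi.single i a) θ = Complex.exp (I * a * θ i) := by
  rw [character, Finset.prod_eq_single i]
  · simp
  · intro j _ hj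
    simp [hj]
  · simp

theorem sum_character_steps (θ : Fin d → ℝ) :
    ∑ e ∈ steps d, character e θ = ((2 * ∑ j, Real.cos (θ j) : ℝ) : ℂ) := by
  rw [sum_steps]
  push_cast
  rw [Finset.mul_sum]
  refine Finset.sum_congr rfl fun j _ => ?_
  rw [character_single, character_single, Complex.two_cos]
  congr 2 <;> push_cast <;> ring

theorem integral_exp_int (m : ℤ) :
    ∫ t in Set.Ioc (-π) π, Complex.exp (I * m * t) = if m = 0 then ((2 * π : ℝ) : ℂ) else 0 := by
  rw [← intervalIntegral.integral_of_le (by linarith [pi_pos])]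
  split_ifs with h
  · subst h
    simp
    ring
  · have hc : I * (m : ℂ) ≠ 0 := by simp [h]
    rw [integral_exp_mul_complex hc, div_eq_zero_iff]
    left
    rw [sub_eq_zero, Complex.exp_eq_exp_iff_exists_int]
    exact ⟨m, by push_cast; ring⟩

theorem integral_character (x : V d) :
    ∫ θ, character x θ ∂torusMeasure d = if x = 0 then ((2 * π : ℝ) : ℂ) ^ d else 0 := by
  unfold character torusMeasure
  rw [integral_fintype_prod_eq_prod (fun j (t : ℝ) => Complex.exp (I * x j * t))]
  simp only [integral_exp_int]
  split_ifs with h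
  · simp [h]
  · obtain ⟨j, hj⟩ := Function.ne_iff.1 h
    exact Finset.prod_eq_zero (Finset.mem_univ j) (if_neg hj)

theorem fourier_inversion (hd : 0 < d) (n : ℕ) (z : V d) :
    ((2 * π : ℝ) : ℂ) ^ d * (heatKernel d n z * ((2 * d : ℕ) : ℝ) ^ n : ℝ) =
      ∫ θ, ((2 * ∑ j, Real.cos (θ j) : ℝ) : ℂ) ^ n * character (-z) θ ∂torusMeasure d := by
  have hne : ((2 * d : ℕ) : ℝ) ^ n ≠ 0 := by positivity
  rw [heatKernel, probN_eq_expN, expN_eq, div_mul_cancel₀ _ hne]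
  have key : ∀ θ : Fin d → ℝ, ((2 * ∑ j, Real.cos (θ j) : ℝ) : ℂ) ^ n * character (-z) θ =
      ∑ s ∈ Fintype.piFinset fun _ : Fin n => steps d, character (pos 0 (extend s) n + -z) θ := by
    intro θ
    simp only [character_add, ← Finset.sum_mul, ← sum_character_steps]
    congr 1
    have : ∀ s : Fin n → V d, character (pos 0 (extend s) n) θ = ∏ i, character (s i) θ := by
      intro s
      rw [pos, zero_add, Finset.sum_range, character_sum]
      simp [extend]
    simp only [this]
    rw [← Finset.prod_univ_sum (fun _ : Fin n => steps d) fun _ e => character e θ]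
    simp
  simp only [key]
  rw [integral_finsetSum _ fun s _ =>
    Integrable.of_bound (continuous_character _).aestronglyMeasurable 1
      (Filter.Eventually.of_forall fun θ => (norm_character _ _).le)]
  simp only [integral_character]
  push_cast
  rw [Finset.mul_sum]
  refine Finset.sum_congr rfl fun s _ => ?_
  split_ifs <;> simp_all [add_neg_eq_zero]

theorem setIntegral_exp_cos_sub_one_le {b : ℝ} (hb : 0 < b) :
    ∫ t in Set.Ioc (-π) π, Real.exp (-(b * (1 - Real.cos t))) ≤ √(π ^ 3 / (2 * b)) := by
  have hpos : 0 < b * (2 / π ^ 2) := by positivity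
  have hint := integrable_exp_neg_mul_sq hpos
  calc ∫ t in Set.Ioc (-π) π, Real.exp (-(b * (1 - Real.cos t)))
      ≤ ∫ t in Set.Ioc (-π) π, Real.exp (-(b * (2 / π ^ 2)) * t ^ 2) := by
        refine setIntegral_mono_on ?_ hint.integrableOn measurableSet_Ioc fun t ht => ?_
        · exact (Continuous.integrableOn_Icc (by fun_prop)).mono_set Set.Ioc_subset_Icc_self
        · have := Real.cos_le_one_sub_mul_cos_sq (x := t) (abs_le.2 ⟨ht.1.le, ht.2⟩)
          apply Real.exp_le_exp.2
          have h2 : b * (2 / π ^ 2 * t ^ 2) ≤ b * (1 - Real.cos t) := by gcongr; linarith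
          linarith
    _ ≤ ∫ t, Real.exp (-(b * (2 / π ^ 2)) * t ^ 2) :=
        setIntegral_le_integral hint (Filter.Eventually.of_forall fun t => (Real.exp_pos _).le)
    _ = √(π ^ 3 / (2 * b)) := by
        rw [integral_gaussian]
        congr 1
        field_simp

theorem setIntegral_exp_neg_cos_add_one (b : ℝ) :
    ∫ t in Set.Ioc (-π) π, Real.exp (-(b * (1 + Real.cos t))) =
      ∫ t in Set.Ioc (-π) π, Real.exp (-(b * (1 - Real.cos t))) := by
  have hle : -π ≤ π := by linarith [pi_pos]
  rw [← intervalIntegral.integral_of_le hle, ← intervalIntegral.integral_of_le hle]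
  have hper : Function.Periodic (fun t => Real.exp (-(b * (1 - Real.cos t)))) (2 * π) := by
    intro t
    simp
  have h1 := hper.intervalIntegral_add_eq (-π) 0
  have h2 := intervalIntegral.integral_comp_add_right
    (a := -π) (b := π) (fun t => Real.exp (-(b * (1 - Real.cos t)))) π
  simp only [Real.cos_add_pi, sub_neg_eq_add] at h2
  rw [h2]
  convert h1.symm using 2 <;> ring

theorem abs_pow_le_exp_add_exp (x : ℝ) (n : ℕ) :
    |x| ^ n ≤ Real.exp (-(n * (1 - x))) + Real.exp (-(n * (1 + x))) := by
  have h : ∀ y : ℝ, 0 ≤ y → y ^ n ≤ Real.exp (-(n * (1 - y))) := by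
    intro y hy
    have : y ≤ Real.exp (y - 1) := by linarith [Real.add_one_le_exp (y - 1)]
    calc y ^ n ≤ Real.exp (y - 1) ^ n := by gcongr
      _ = _ := by rw [← Real.exp_nat_mul]; congr 1; ring
  rcases abs_cases x with ⟨h1, h2⟩ | ⟨h1, h2⟩
  · rw [h1]
    linarith [h x h2, Real.exp_pos (-(n * (1 + x)))]
  · rw [h1]
    have := h (-x) (by linarith)
    rw [sub_neg_eq_add] at this
    linarith [Real.exp_pos (-(n * (1 - x)))]

theorem integral_abs_sum_cos_pow_le (hd : 0 < d) {n : ℕ} (hn : 0 < n) :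
    ∫ θ, |(∑ j, Real.cos (θ j)) / d| ^ n ∂torusMeasure d ≤ 2 * √(π ^ 3 * d / (2 * n)) ^ d := by
  have hd' : (0 : ℝ) < d := by exact_mod_cast hd
  have hn' : (0 : ℝ) < n := by exact_mod_cast hn
  have hb : (0 : ℝ) < n / d := by positivity
  have hbd : ∀ θ : Fin d → ℝ, |(∑ j, Real.cos (θ j)) / d| ≤ 1 := by
    intro θ
    rw [abs_div, Nat.abs_cast, div_le_one hd']
    calc |∑ j, Real.cos (θ j)| ≤ ∑ j, |Real.cos (θ j)| := Finset.abs_sum_le_sum_abs _ _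
      _ ≤ ∑ j : Fin d, 1 := Finset.sum_le_sum fun j _ => Real.abs_cos_le_one _
      _ = d := by simp
  have hprod : ∀ ε : ℝ, ∀ θ : Fin d → ℝ,
      Real.exp (-(n * (1 + ε * ((∑ j, Real.cos (θ j)) / d)))) =
        ∏ j, Real.exp (-(n / d * (1 + ε * Real.cos (θ j)))) := by
    intro ε θ
    rw [← Real.exp_sum]
    congr 1
    simp only [Finset.sum_neg_distrib, ← Finset.mul_sum, Finset.sum_add_distrib]
    simp
    field_simp
  have hint : ∀ ε : ℝ, Integrable (fun θ : Fin d → ℝ =>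
      ∏ j, Real.exp (-(n / d * (1 + ε * Real.cos (θ j))))) (torusMeasure d) := by
    intro ε
    refine Integrable.fintype_prod (f := fun _ t => Real.exp (-(n / d * (1 + ε * Real.cos t))))
      fun j => ?_
    exact (Continuous.integrableOn_Icc (by fun_prop)).mono_set Set.Ioc_subset_Icc_self
  have hval : ∀ ε : ℝ, ∫ θ : Fin d → ℝ,
      ∏ j, Real.exp (-(n / d * (1 + ε * Real.cos (θ j)))) ∂torusMeasure d =
      (∫ t in Set.Ioc (-π) π, Real.exp (-(n / d * (1 + ε * Real.cos t)))) ^ d := by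
    intro ε
    rw [torusMeasure, integral_fintype_prod_eq_pow
      (fun t => Real.exp (-(n / d * (1 + ε * Real.cos t)))), Fintype.card_fin]
  have hgauss : (∫ t in Set.Ioc (-π) π, Real.exp (-(n / d * (1 - Real.cos t)))) ^ d ≤
      √(π ^ 3 * d / (2 * n)) ^ d := by
    refine pow_le_pow_left₀ (integral_nonneg fun t => (Real.exp_pos _).le) ?_ d
    refine (setIntegral_exp_cos_sub_one_le hb).trans_eq ?_
    congr 1
    field_simp
  calc ∫ θ, |(∑ j, Real.cos (θ j)) / d| ^ n ∂torusMeasure d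
      ≤ ∫ θ, (∏ j, Real.exp (-(n / d * (1 + (-1) * Real.cos (θ j)))) +
          ∏ j, Real.exp (-(n / d * (1 + 1 * Real.cos (θ j))))) ∂torusMeasure d := by
        refine integral_mono ?_ ((hint _).add (hint _)) fun θ => ?_
        · refine Integrable.of_bound (Continuous.aestronglyMeasurable (by fun_prop)) 1
            (Filter.Eventually.of_forall fun θ => ?_)
          rw [Real.norm_eq_abs, abs_pow, abs_abs]
          exact pow_le_one₀ (abs_nonneg _) (hbd θ)
        · have := abs_pow_le_exp_add_exp ((∑ j, Real.cos (θ j)) / d) n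
          simp only [← hprod]
          simpa [sub_eq_add_neg] using this
    _ = 2 * (∫ t in Set.Ioc (-π) π, Real.exp (-(n / d * (1 - Real.cos t)))) ^ d := by
        rw [integral_add (hint _) (hint _), hval, hval]
        simp only [one_mul, neg_one_mul, ← sub_eq_add_neg, setIntegral_exp_neg_cos_add_one]
        ring
    _ ≤ _ := by gcongr

theorem heatKernel_nonneg (n : ℕ) (z : V d) : 0 ≤ heatKernel d n z := by
  unfold heatKernel probN
  positivity

theorem heatKernel_le_integral (hd : 0 < d) (n : ℕ) (z : V d) :
    (2 * π) ^ d * heatKernel d n z ≤ ∫ θ, |(∑ j, Real.cos (θ j)) / d| ^ n ∂torusMeasure d := by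
  have hd' : (0 : ℝ) < 2 * d := by positivity
  have hpow : (0 : ℝ) < (2 * d) ^ n := by positivity
  have h := congrArg norm (fourier_inversion hd n z)
  rw [norm_mul, norm_pow, Complex.norm_real, Complex.norm_real,
    Real.norm_of_nonneg (by positivity), Real.norm_of_nonneg
      (mul_nonneg (heatKernel_nonneg n z) (by positivity))] at h
  have hle := norm_integral_le_integral_norm (μ := torusMeasure d)
    (fun θ => ((2 * ∑ j, Real.cos (θ j) : ℝ) : ℂ) ^ n * character (-z) θ)
  rw [← h] at hle
  have heq : ∀ θ : Fin d → ℝ, ‖((2 * ∑ j, Real.cos (θ j) : ℝ) : ℂ) ^ n * character (-z) θ‖ =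
      (2 * d) ^ n * |(∑ j, Real.cos (θ j)) / d| ^ n := by
    intro θ
    rw [norm_mul, norm_character, mul_one, norm_pow, Complex.norm_real, Real.norm_eq_abs,
      ← mul_pow, abs_mul, abs_div, Nat.abs_cast, abs_two]
    congr 1
    field_simp
  simp only [heq] at hle
  rw [integral_const_mul] at hle
  push_cast at hle
  refine le_of_mul_le_mul_left ?_ hpow
  linarith

theorem exists_heatKernel_le (hd : 0 < d) :
    ∃ C : ℝ, 0 < C ∧ ∀ (n : ℕ) (z : V d), heatKernel d n z ≤ C * ((n : ℝ) + 1) ^ (-(d / 2 : ℝ)) := by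
  have hd' : (0 : ℝ) < d := by exact_mod_cast hd
  refine ⟨2 * √(π ^ 3 * d) ^ d + 1, by positivity, fun n z => ?_⟩
  rcases Nat.eq_zero_or_pos n with rfl | hn
  · have : heatKernel d 0 z ≤ 1 := by
      rw [heatKernel, probN_eq_expN]
      refine le_of_le_of_eq (expN_mono (g := fun _ => 1) _ fun s => ?_) (expN_const hd 0 1)
      split_ifs <;> norm_num
    have h2 : 0 ≤ √(π ^ 3 * d) ^ d := by positivity
    simp only [Nat.cast_zero, zero_add, Real.one_rpow]
    linarith
  · have hn' : (1 : ℝ) ≤ n := by exact_mod_cast hn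
    have h1 : heatKernel d n z ≤ 2 * √(π ^ 3 * d / (2 * n)) ^ d := by
      have hpi : (1 : ℝ) ≤ (2 * π) ^ d := one_le_pow₀ (by linarith [Real.two_le_pi])
      calc heatKernel d n z ≤ (2 * π) ^ d * heatKernel d n z :=
            le_mul_of_one_le_left (heatKernel_nonneg n z) hpi
        _ ≤ _ := (heatKernel_le_integral hd n z).trans (integral_abs_sum_cos_pow_le hd hn)
    have h2 : √(π ^ 3 * d / (2 * n)) ^ d ≤ √(π ^ 3 * d) ^ d * ((n : ℝ) + 1) ^ (-(d / 2 : ℝ)) := by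
      have : ((n : ℝ) + 1) ^ (-(d / 2 : ℝ)) = (√(1 / (n + 1))) ^ d := by
        rw [one_div, Real.sqrt_inv, inv_pow, Real.rpow_neg (by positivity), Real.sqrt_eq_rpow,
          ← Real.rpow_mul_natCast (by positivity)]
        congr 2
        ring
      rw [this, ← mul_pow, ← Real.sqrt_mul (by positivity)]
      gcongr
      rw [mul_one_div]
      gcongr
      linarith
    have h3 : 0 < ((n : ℝ) + 1) ^ (-(d / 2 : ℝ)) := by positivity
    nlinarith

end HeatKernel

theorem sum_rpow_neg_le {e : ℝ} (he : 1 / 2 ≤ e) (m N : ℕ) :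
    ∑ t ∈ Finset.range N, ((m + t : ℕ) + 1 : ℝ) ^ (-(e + 1)) ≤ 4 * ((m : ℝ) + 1) ^ (-e) := by
  have step : ∀ k : ℝ, 1 ≤ k → k ^ (-(e + 1)) ≤ 4 * (k ^ (-e) - (k + 1) ^ (-e)) := by
    intro k hk
    have hk0 : 0 < k := by linarith
    have hu : (k / (k + 1)) ^ e ≤ 1 - 1 / (4 * k) := by
      have hu1 : k / (k + 1) ≤ 1 := by rw [div_le_one (by linarith)]; linarith
      calc (k / (k + 1)) ^ e ≤ (k / (k + 1)) ^ (1 / 2 : ℝ) :=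
            Real.rpow_le_rpow_of_exponent_ge (by positivity) hu1 he
        _ = √(k / (k + 1)) := (Real.sqrt_eq_rpow _).symm
        _ ≤ 1 - 1 / (4 * k) := by
            have h4 : 1 / (4 * k) ≤ 1 / 4 := by
              rw [div_le_div_iff₀ (by positivity) (by norm_num)]; linarith
            rw [Real.sqrt_le_left (by linarith), div_le_iff₀ (by linarith)]
            have : (1 - 1 / (4 * k)) ^ 2 * (k + 1) - k =
                (8 * k * (k - 1) + k + 1) / (16 * k ^ 2) := by
              field_simp
              ring
            have h2 : 0 ≤ (8 * k * (k - 1) + k + 1) / (16 * k ^ 2) := by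
              have : 0 ≤ 8 * k * (k - 1) := mul_nonneg (by positivity) (by linarith)
              positivity
            linarith
    have h1 : (k + 1) ^ (-e) = k ^ (-e) * (k / (k + 1)) ^ e := by
      rw [Real.div_rpow hk0.le (by linarith), Real.rpow_neg hk0.le, Real.rpow_neg (by linarith)]
      have := Real.rpow_pos_of_pos hk0 e
      field_simp
    have h2 : k ^ (-(e + 1)) = k ^ (-e) * (1 / k) := by
      rw [neg_add, Real.rpow_add hk0, Real.rpow_neg_one, one_div]
    rw [h1, h2]
    have h3 : 0 < k ^ (-e) := Real.rpow_pos_of_pos hk0 _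
    have h4 : 1 / (4 * k) = 1 / k / 4 := by field_simp
    rw [h4] at hu
    nlinarith
  have htel : ∀ N : ℕ, ∑ t ∈ Finset.range N, ((m + t : ℕ) + 1 : ℝ) ^ (-(e + 1)) ≤
      4 * (((m : ℝ) + 1) ^ (-e) - ((m + N : ℕ) + 1 : ℝ) ^ (-e)) := by
    intro N
    induction N with
    | zero => simp
    | succ N ih =>
      rw [Finset.sum_range_succ]
      have := step ((m + N : ℕ) + 1) (by simp; positivity)
      have h2 : ((m + (N + 1) : ℕ) + 1 : ℝ) = ((m + N : ℕ) + 1 : ℝ) + 1 := by push_cast; ring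
      rw [h2]
      linarith
  have : 0 ≤ ((m + N : ℕ) + 1 : ℝ) ^ (-e) := by positivity
  linarith [htel N]

section Green

variable {d : ℕ}

theorem exists_sum_heatKernel_le (hd : 5 ≤ d) :
    ∃ C : ℝ, 0 < C ∧ ∀ (z : V d) (m N : ℕ),
      ∑ t ∈ Finset.range N, heatKernel d (m + t) z ≤ C * ((m : ℝ) + 1) ^ (-(d / 2 - 1 : ℝ)) := by
  obtain ⟨C, hC, h⟩ := exists_heatKernel_le (d := d) (by omega)
  have hd' : (5 : ℝ) ≤ d := by exact_mod_cast hd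
  refine ⟨C * 4, by positivity, fun z m N => ?_⟩
  calc ∑ t ∈ Finset.range N, heatKernel d (m + t) z
      ≤ ∑ t ∈ Finset.range N, C * ((m + t : ℕ) + 1 : ℝ) ^ (-((d / 2 - 1 : ℝ) + 1)) := by
        refine Finset.sum_le_sum fun t _ => ?_
        rw [sub_add_cancel]
        exact h _ _
    _ ≤ _ := by
        rw [← Finset.mul_sum, mul_assoc]
        gcongr
        exact sum_rpow_neg_le (by linarith) m N

theorem summable_heatKernel (hd : 5 ≤ d) (z : V d) : Summable fun t => heatKernel d t z := by
  obtain ⟨C, _, h⟩ := exists_sum_heatKernel_le hd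
  refine summable_of_sum_range_le
    (c := C * ((0 : ℕ) + 1 : ℝ) ^ (-(d / 2 - 1 : ℝ))) (fun t => heatKernel_nonneg t z) fun N => ?_
  simpa using h z 0 N

theorem G_eq_tsum (z : V d) : G d z = ∑' t, heatKernel d t z := rfl

theorem G_nonneg (z : V d) : 0 ≤ G d z := tsum_nonneg fun t => heatKernel_nonneg t z

theorem one_le_G_zero (hd : 5 ≤ d) : 1 ≤ G d 0 := by
  have h := (summable_heatKernel hd (0 : V d)).le_tsum 0 fun t _ => heatKernel_nonneg t 0
  have h0 : heatKernel d 0 (0 : V d) = 1 := by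
    simp [heatKernel, probN_eq_expN, pos, expN_const (show 0 < d by omega)]
  rwa [h0] at h

theorem expN_heatKernel_neg_pos (a t : ℕ) :
    expN d a (fun s => heatKernel d t (-pos 0 s a)) = heatKernel d (a + t) 0 := by
  simp only [heatKernel, probN_eq_expN, expN_add, pos_concat_add]
  simp only [eq_neg_iff_add_eq_zero, add_comm]

theorem expN_G_neg_pos (hd : 5 ≤ d) (a : ℕ) :
    expN d a (fun s => G d (-pos 0 s a)) = ∑' t, heatKernel d (a + t) 0 := by
  simp only [G_eq_tsum]
  rw [expN_tsum _ _ fun s => summable_heatKernel hd _]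
  simp only [expN_heatKernel_neg_pos]

theorem expN_G_pos (hd : 5 ≤ d) (a : ℕ) :
    expN d a (fun s => G d (pos 0 s a)) = ∑' t, heatKernel d (a + t) 0 := by
  rw [← expN_G_neg_pos hd, ← expN_neg]
  simp only [pos_neg]

theorem expN_G_increment (hd : 5 ≤ d) {i a n : ℕ} (h : i + a ≤ n) :
    expN d n (fun s => G d (pos 0 s (i + a) - pos 0 s i)
      + G d (pos 0 s i - pos 0 s (i + a))) = 2 * ∑' t, heatKernel d (a + t) 0 := by
  have hd0 : 0 < d := by omega
  obtain ⟨r, rfl⟩ := Nat.exists_eq_add_of_le h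
  rw [add_assoc, expN_concat_right hd0 i (a + r)
    (g := fun s => G d (pos 0 s a) + G d (-pos 0 s a)), expN_concat_left hd0 a r
    (g := fun s => G d (pos 0 s a) + G d (-pos 0 s a)), expN_add_fun, expN_G_pos hd,
    expN_G_neg_pos hd, two_mul]
  · intro s s'
    rw [pos_concat_of_le _ le_rfl]
  · intro s s'
    rw [pos_concat_add, pos_concat_of_le _ le_rfl]
    simp

end Green

section Capacity

variable {d : ℕ}

theorem probN_nonneg (n : ℕ) (P : (ℕ → V d) → Prop) : 0 ≤ probN d n P := by
  unfold probN
  positivity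

theorem probN_mono (n : ℕ) {P Q : (ℕ → V d) → Prop} (h : ∀ s, P s → Q s) :
    probN d n P ≤ probN d n Q := by
  classical
  simp only [probN_eq_expN]
  refine expN_mono _ fun s => ?_
  have := h s
  split_ifs <;> simp_all

theorem esc_le_probN (A : Set (V d)) (x : V d) (n : ℕ) :
    esc d A x ≤ probN d n (fun s => ∀ k, 1 ≤ k → k ≤ n → pos x s k ∉ A) :=
  ciInf_le ⟨0, by rintro _ ⟨n, rfl⟩; exact probN_nonneg _ _⟩ n

theorem esc_nonneg (A : Set (V d)) (x : V d) : 0 ≤ esc d A x :=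
  le_ciInf fun _ => probN_nonneg _ _

theorem esc_le_one (hd : 0 < d) (A : Set (V d)) (x : V d) : esc d A x ≤ 1 := by
  classical
  refine (esc_le_probN A x 0).trans ?_
  rw [probN_eq_expN]
  refine le_of_le_of_eq (expN_mono (g := fun _ => 1) _ fun s => ?_) (expN_const hd 0 1)
  split_ifs <;> norm_num

theorem esc_anti {A B : Set (V d)} (h : A ⊆ B) (x : V d) : esc d B x ≤ esc d A x :=
  le_ciInf fun n => (esc_le_probN B x n).trans <|
    probN_mono n fun _ hs k h1 h2 hA => hs k h1 h2 (h hA)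

theorem probN_pos_eq (hd : 0 < d) (x y : V d) {k n : ℕ} (h : k ≤ n) :
    probN d n (fun s => pos x s k = y) = heatKernel d k (y - x) := by
  classical
  obtain ⟨r, rfl⟩ := Nat.exists_eq_add_of_le h
  rw [heatKernel, probN_eq_expN, probN_eq_expN]
  refine expN_concat_left hd k r fun s s' => ?_
  simp only [pos_concat_of_le _ le_rfl, pos_eq_add x, eq_sub_iff_add_eq']

theorem esc_le_esc_union_add (hd : 5 ≤ d) (A B : Finset (V d)) (x : V d) :
    esc d (A : Set (V d)) x ≤ esc d ((A ∪ B : Finset (V d)) : Set (V d)) x + ∑ y ∈ B, G d (y - x) := by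
  classical
  rw [← sub_le_iff_le_add]
  refine le_ciInf fun n => ?_
  rw [sub_le_iff_le_add]
  refine (esc_le_probN _ x n).trans ?_
  have h : probN d n (fun s => ∀ k, 1 ≤ k → k ≤ n → pos x s k ∉ (A : Set (V d))) ≤
      probN d n (fun s => ∀ k, 1 ≤ k → k ≤ n → pos x s k ∉ ((A ∪ B : Finset (V d)) : Set (V d))) +
        ∑ y ∈ B, ∑ k ∈ Finset.range (n + 1), probN d n (fun s => pos x s k = y) := by
    simp only [probN_eq_expN, ← expN_sum, ← expN_add_fun]
    refine expN_mono n fun s => ?_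
    have hnn : 0 ≤ ∑ y ∈ B, ∑ k ∈ Finset.range (n + 1), (if pos x s k = y then (1 : ℝ) else 0) :=
      Finset.sum_nonneg fun y _ => Finset.sum_nonneg fun k _ => by split_ifs <;> norm_num
    by_cases h1 : ∀ k, 1 ≤ k → k ≤ n → pos x s k ∉ (A : Set (V d))
    · rw [if_pos h1]
      by_cases h2 : ∀ k, 1 ≤ k → k ≤ n → pos x s k ∉ ((A ∪ B : Finset (V d)) : Set (V d))
      · rw [if_pos h2]
        linarith
      · rw [if_neg h2, zero_add]
        push Not at h2
        obtain ⟨k, hk1, hkn, hk⟩ := h2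
        have hB : pos x s k ∈ B := by
          have := h1 k hk1 hkn
          simp_all
        calc (1 : ℝ) = if pos x s k = pos x s k then 1 else 0 := by simp
          _ ≤ ∑ j ∈ Finset.range (n + 1), (if pos x s j = pos x s k then (1 : ℝ) else 0) :=
              Finset.single_le_sum (f := fun j => if pos x s j = pos x s k then (1 : ℝ) else 0)
                (fun j _ => by split_ifs <;> norm_num) (Finset.mem_range.2 (by omega))
          _ ≤ _ := Finset.single_le_sum
                (f := fun y => ∑ j ∈ Finset.range (n + 1), if pos x s j = y then (1 : ℝ) else 0)
                (fun y _ => Finset.sum_nonneg fun j _ => by split_ifs <;> norm_num) hB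
    · rw [if_neg h1]
      exact add_nonneg (by split_ifs <;> norm_num) hnn
  refine h.trans ?_
  gcongr with y hy
  calc ∑ k ∈ Finset.range (n + 1), probN d n (fun s => pos x s k = y)
      = ∑ k ∈ Finset.range (n + 1), heatKernel d k (y - x) :=
        Finset.sum_congr rfl fun k hk =>
          probN_pos_eq (by omega) x y (by have := Finset.mem_range.1 hk; omega)
    _ ≤ G d (y - x) := (summable_heatKernel hd _).sum_le_tsum _ fun k _ => heatKernel_nonneg k _

theorem cap_nonneg (A : Finset (V d)) : 0 ≤ cap A :=
  Finset.sum_nonneg fun x _ => esc_nonneg _ x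

theorem cap_union_le (A B : Finset (V d)) : cap (A ∪ B) ≤ cap A + cap B := by
  have h := Finset.sum_union_inter (s₁ := A) (s₂ := B)
    (f := fun x => esc d ((A ∪ B : Finset (V d)) : Set (V d)) x)
  have h0 : 0 ≤ ∑ x ∈ A ∩ B, esc d ((A ∪ B : Finset (V d)) : Set (V d)) x :=
    Finset.sum_nonneg fun x _ => esc_nonneg _ x
  have hA : ∑ x ∈ A, esc d ((A ∪ B : Finset (V d)) : Set (V d)) x ≤ cap A :=
    Finset.sum_le_sum fun x _ => esc_anti (by simp) x
  have hB : ∑ x ∈ B, esc d ((A ∪ B : Finset (V d)) : Set (V d)) x ≤ cap B :=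
    Finset.sum_le_sum fun x _ => esc_anti (by simp) x
  unfold cap at hA hB ⊢
  linarith

theorem cap_add_cap_le (hd : 5 ≤ d) (A B : Finset (V d)) :
    cap A + cap B ≤ cap (A ∪ B) + ∑ x ∈ A, ∑ y ∈ B, (G d (y - x) + G d (x - y)) := by
  classical
  have hA : cap A ≤ ∑ x ∈ A, (esc d ((A ∪ B : Finset (V d)) : Set (V d)) x
      + ∑ y ∈ B, G d (y - x)) :=
    Finset.sum_le_sum fun x _ => esc_le_esc_union_add hd A B x
  have hB : cap B ≤ ∑ y ∈ B, ((if y ∈ A then 0 else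
      esc d ((A ∪ B : Finset (V d)) : Set (V d)) y) + ∑ x ∈ A, G d (x - y)) := by
    refine Finset.sum_le_sum fun y _ => ?_
    split_ifs with hy
    · calc esc d (B : Set (V d)) y ≤ G d (y - y) := by
            rw [sub_self]
            exact (esc_le_one (by omega) _ y).trans (one_le_G_zero hd)
        _ ≤ ∑ x ∈ A, G d (x - y) :=
            Finset.single_le_sum (f := fun x => G d (x - y)) (fun x _ => G_nonneg _) hy
        _ = _ := (zero_add _).symm
    · rw [Finset.union_comm]
      exact esc_le_esc_union_add hd B A y
  have hU : cap (A ∪ B) = ∑ x ∈ A, esc d ((A ∪ B : Finset (V d)) : Set (V d)) x +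
      ∑ y ∈ B, (if y ∈ A then 0 else esc d ((A ∪ B : Finset (V d)) : Set (V d)) y) := by
    rw [cap]
    nth_rewrite 1 [← Finset.union_sdiff_self_eq_union]
    rw [Finset.sum_union Finset.disjoint_sdiff]
    congr 1
    rw [Finset.sdiff_eq_filter, Finset.sum_filter]
    exact Finset.sum_congr rfl fun y _ => by split_ifs <;> simp_all
  rw [hU]
  simp only [Finset.sum_add_distrib] at hA hB ⊢
  rw [Finset.sum_comm (s := B)] at hB
  linarith

theorem cap_translate (A : Finset (V d)) (v : V d) : cap (A.image (v + ·)) = cap A := by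
  rw [cap, Finset.sum_image (fun _ _ _ _ h => add_left_cancel h)]
  refine Finset.sum_congr rfl fun x _ => ?_
  simp only [esc]
  congr! 5 with n s
  simp [pos_eq_add (v + x), pos_eq_add x, add_assoc]

end Capacity

section Range

variable {d : ℕ}

theorem rangeOn_eq_image_sub (s : ℕ → V d) (m : ℕ) :
    rangeOn 0 s (Finset.Icc 0 m) = (Finset.range (m + 1)).image fun i => pos 0 s (m - i) := by
  ext x
  simp only [rangeOn, Finset.mem_image, Finset.mem_Icc, Finset.mem_range]
  constructor
  · rintro ⟨k, hk, rfl⟩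
    exact ⟨m - k, by omega, by congr 1; omega⟩
  · rintro ⟨k, hk, rfl⟩
    exact ⟨m - k, by omega, rfl⟩

theorem rangeOn_eq_image_add (s : ℕ → V d) (m n : ℕ) :
    rangeOn 0 s (Finset.Icc m (m + n)) = (Finset.range (n + 1)).image fun j => pos 0 s (m + j) := by
  ext x
  simp only [rangeOn, Finset.mem_image, Finset.mem_Icc, Finset.mem_range]
  constructor
  · rintro ⟨k, hk, rfl⟩
    exact ⟨k - m, by omega, by congr 1; omega⟩
  · rintro ⟨k, hk, rfl⟩
    exact ⟨m + k, by omega, rfl⟩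

theorem rangeOn_union (s : ℕ → V d) (m n : ℕ) :
    rangeOn 0 s (Finset.Icc 0 m) ∪ rangeOn 0 s (Finset.Icc m (m + n)) =
      rangeOn 0 s (Finset.Icc 0 (m + n)) := by
  rw [rangeOn, rangeOn, ← Finset.image_union, rangeOn]
  congr 1
  ext k
  simp only [Finset.mem_union, Finset.mem_Icc]
  omega

theorem expN_cap_past (hd : 0 < d) (m n : ℕ) :
    expN d (m + n) (fun s => cap (rangeOn 0 s (Finset.Icc 0 m))) = expCapRange d m := by
  refine expN_concat_left hd m n fun s s' => ?_
  rw [rangeOn, rangeOn, Finset.image_congr fun k hk => ?_]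
  exact pos_concat_of_le 0 (Finset.mem_Icc.1 hk).2 s s'

theorem expN_cap_future (hd : 0 < d) (m n : ℕ) :
    expN d (m + n) (fun s => cap (rangeOn 0 s (Finset.Icc m (m + n)))) = expCapRange d n := by
  refine expN_concat_right hd m n fun s s' => ?_
  rw [← cap_translate (rangeOn 0 s' (Finset.Icc 0 n)) (pos 0 s m), rangeOn_eq_image_add]
  have h := rangeOn_eq_image_add s' 0 n
  simp only [zero_add] at h
  rw [h, Finset.image_image]
  congr 2 with j
  simp [pos_concat_add]

theorem expCapRange_nonneg (n : ℕ) : 0 ≤ expCapRange d n :=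
  div_nonneg (Finset.sum_nonneg fun _ _ => cap_nonneg _) (by positivity)

theorem expCapRange_add_le (hd : 0 < d) (m n : ℕ) :
    expCapRange d (m + n) ≤ expCapRange d m + expCapRange d n := by
  rw [← expN_cap_past hd m n, ← expN_cap_future hd m n, ← expN_add_fun]
  refine expN_mono _ fun s => ?_
  rw [← rangeOn_union]
  exact cap_union_le _ _

theorem expCapRange_add_ge (hd : 5 ≤ d) (m n : ℕ) :
    expCapRange d m + expCapRange d n ≤ expCapRange d (m + n) +
      ∑ i ∈ Finset.range (m + 1), ∑ j ∈ Finset.range (n + 1),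
        2 * ∑' t, heatKernel d (i + j + t) 0 := by
  have hd0 : 0 < d := by omega
  rw [← expN_cap_past hd0 m n, ← expN_cap_future hd0 m n, ← expN_add_fun]
  have hsum : ∑ i ∈ Finset.range (m + 1), ∑ j ∈ Finset.range (n + 1),
        2 * ∑' t, heatKernel d (i + j + t) 0 =
      expN d (m + n) fun s => ∑ i ∈ Finset.range (m + 1), ∑ j ∈ Finset.range (n + 1),
        (G d (pos 0 s (m + j) - pos 0 s (m - i)) + G d (pos 0 s (m - i) - pos 0 s (m + j))) := by
    simp only [expN_sum]
    refine Finset.sum_congr rfl fun i hi => Finset.sum_congr rfl fun j hj => ?_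
    rw [Finset.mem_range] at hi hj
    rw [← expN_G_increment hd (i := m - i) (n := m + n) (by omega),
      show m - i + (i + j) = m + j by omega]
  rw [hsum, expCapRange, ← expN_add_fun]
  refine expN_mono _ fun s => ?_
  rw [← rangeOn_union]
  refine (cap_add_cap_le hd _ _).trans ?_
  gcongr
  rw [rangeOn_eq_image_sub, rangeOn_eq_image_add]
  have hG : ∀ x y : V d, 0 ≤ G d (y - x) + G d (x - y) :=
    fun x y => add_nonneg (G_nonneg _) (G_nonneg _)
  refine (Finset.sum_image_le_of_nonneg fun x _ => Finset.sum_nonneg fun y _ => hG _ _).trans ?_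
  exact Finset.sum_le_sum fun i _ =>
    Finset.sum_image_le_of_nonneg fun y _ => hG (pos 0 s (m - i)) y

end Range

/-- The order `ψ_d(n)` of the deviation of the expected capacity from linear growth. -/
noncomputable def errorOrder (d n : ℕ) : ℝ :=
  if d = 5 then Real.sqrt n else if d = 6 then Real.log n else 1

theorem errorOrder_nonneg (d n : ℕ) : 0 ≤ errorOrder d n := by
  unfold errorOrder
  split_ifs
  · positivity
  · exact Real.log_natCast_nonneg n
  · norm_num

theorem sum_range_rpow_le_errorOrder {d : ℕ} (hd : 5 ≤ d) {n : ℕ} (hn : 2 ≤ n) :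
    ∑ i ∈ Finset.range (n + 1), ((i : ℝ) + 1) ^ (-(d / 2 - 2 : ℝ)) ≤ 4 * errorOrder d n := by
  have hn' : (2 : ℝ) ≤ n := by exact_mod_cast hn
  unfold errorOrder
  split_ifs with h5 h6
  · subst h5
    have h : ∀ N : ℕ, ∑ i ∈ Finset.range N, ((i : ℝ) + 1) ^ (-(((5 : ℕ) : ℝ) / 2 - 2)) ≤
        2 * √N := by
      intro N
      induction N with
      | zero => simp
      | succ N ih =>
        rw [Finset.sum_range_succ]
        have he : ((N : ℝ) + 1) ^ (-(((5 : ℕ) : ℝ) / 2 - 2)) = 1 / √(N + 1) := by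
          rw [Real.rpow_neg (by positivity), Real.sqrt_eq_rpow, one_div]
          norm_num
        have hs : 0 < √((N : ℝ) + 1) := by positivity
        have h1 := Real.sq_sqrt (show (0 : ℝ) ≤ N by positivity)
        have h2 := Real.sq_sqrt (show (0 : ℝ) ≤ N + 1 by positivity)
        have h3 : 1 / √((N : ℝ) + 1) ≤ 2 * (√(N + 1) - √N) := by
          rw [div_le_iff₀ hs]
          nlinarith [sq_nonneg (√((N : ℝ) + 1) - √N)]
        rw [he]
        push_cast
        linarith
    refine (h (n + 1)).trans ?_
    have : √((n + 1 : ℕ) : ℝ) ≤ 2 * √n := by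
      rw [Real.sqrt_le_left (by positivity), mul_pow, Real.sq_sqrt (by positivity)]
      push_cast
      linarith
    linarith
  · subst h6
    have h := harmonic_le_one_add_log (n + 1)
    have he : ∑ i ∈ Finset.range (n + 1), ((i : ℝ) + 1) ^ (-(((6 : ℕ) : ℝ) / 2 - 2)) =
        (harmonic (n + 1) : ℝ) := by
      simp only [harmonic]
      push_cast
      refine Finset.sum_congr rfl fun i _ => ?_
      rw [show (-((6 : ℝ) / 2 - 2)) = -1 by norm_num, Real.rpow_neg_one]
    rw [he]
    have h1 : Real.log ((n + 1 : ℕ) : ℝ) ≤ 2 * Real.log n := by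
      rw [← Real.log_rpow (by linarith)]
      apply Real.log_le_log (by positivity)
      rw [Real.rpow_two]
      push_cast
      nlinarith
    have h2 : Real.log 2 ≤ Real.log n := Real.log_le_log (by norm_num) hn'
    linarith [Real.log_two_gt_d9]
  · have hd7 : (7 : ℝ) ≤ d := by exact_mod_cast (show 7 ≤ d by omega)
    calc ∑ i ∈ Finset.range (n + 1), ((i : ℝ) + 1) ^ (-(d / 2 - 2 : ℝ))
        ≤ ∑ i ∈ Finset.range (n + 1), ((0 + i : ℕ) + 1 : ℝ) ^ (-((1 / 2 : ℝ) + 1)) := by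
          refine Finset.sum_le_sum fun i _ => ?_
          rw [zero_add]
          exact Real.rpow_le_rpow_of_exponent_le (by simp) (by linarith)
      _ ≤ 4 * (((0 : ℕ) : ℝ) + 1) ^ (-(1 / 2 : ℝ)) := sum_rpow_neg_le le_rfl 0 _
      _ = 4 * 1 := by simp

theorem exists_two_mul_expCapRange_le {d : ℕ} (hd : 5 ≤ d) :
    ∃ K : ℝ, 0 < K ∧ ∀ n : ℕ, 2 ≤ n →
      2 * expCapRange d n ≤ expCapRange d (2 * n) + K * errorOrder d n := by
  obtain ⟨C, hC, h⟩ := exists_sum_heatKernel_le hd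
  have hd' : (5 : ℝ) ≤ d := by exact_mod_cast hd
  refine ⟨2 * C * 4 * 4, by positivity, fun n hn => ?_⟩
  have hsum : ∑ i ∈ Finset.range (n + 1), ∑ j ∈ Finset.range (n + 1),
      2 * ∑' t, heatKernel d (i + j + t) 0 ≤ 2 * C * 4 * 4 * errorOrder d n := by
    calc ∑ i ∈ Finset.range (n + 1), ∑ j ∈ Finset.range (n + 1),
          2 * ∑' t, heatKernel d (i + j + t) 0
        ≤ ∑ i ∈ Finset.range (n + 1), ∑ j ∈ Finset.range (n + 1),
          2 * (C * ((i + j : ℕ) + 1 : ℝ) ^ (-((d / 2 - 2 : ℝ) + 1))) := by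
          gcongr with i _ j _
          rw [show (d / 2 - 2 : ℝ) + 1 = d / 2 - 1 by ring]
          exact Real.tsum_le_of_sum_range_le (fun t => heatKernel_nonneg _ _) (h 0 (i + j))
      _ ≤ ∑ i ∈ Finset.range (n + 1), 2 * C * (4 * ((i : ℝ) + 1) ^ (-(d / 2 - 2 : ℝ))) := by
          gcongr with i _
          simp only [← mul_assoc (2 : ℝ) C]
          rw [← Finset.mul_sum]
          gcongr
          exact sum_rpow_neg_le (by linarith) i _
      _ = 2 * C * 4 * ∑ i ∈ Finset.range (n + 1), ((i : ℝ) + 1) ^ (-(d / 2 - 2 : ℝ)) := by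
          rw [Finset.mul_sum]
          exact Finset.sum_congr rfl fun i _ => by ring
      _ ≤ 2 * C * 4 * (4 * errorOrder d n) := by
          gcongr
          exact sum_range_rpow_le_errorOrder hd hn
      _ = _ := by ring
  have := expCapRange_add_ge hd n n
  rw [← two_mul, ← two_mul] at this
  linarith

/-- A correction of order `ψ_d` whose defect of linearity under doubling dominates `ψ_d`. -/
theorem exists_doubling_corrector (d : ℕ) :
    ∃ h : ℕ → ℝ, ∀ n : ℕ, 2 ≤ n → 0 ≤ h n ∧ h n ≤ 2 * errorOrder d n ∧
      errorOrder d n ≤ 2 * h n - h (2 * n) := by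
  unfold errorOrder
  split_ifs with h5 h6
  · refine ⟨fun n => 2 * √n, fun n _ => ⟨by positivity, le_rfl, ?_⟩⟩
    push_cast
    rw [Real.sqrt_mul (by norm_num)]
    have h2 : √2 ≤ 3 / 2 := by
      rw [Real.sqrt_le_left (by norm_num)]
      norm_num
    nlinarith [Real.sqrt_nonneg (n : ℝ)]
  · refine ⟨fun n => Real.log n + Real.log 2, fun n hn => ?_⟩
    have hn' : (2 : ℝ) ≤ n := by exact_mod_cast hn
    have h2 : Real.log 2 ≤ Real.log n := Real.log_le_log (by norm_num) hn'
    have h0 : 0 < Real.log 2 := Real.log_pos (by norm_num)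
    refine ⟨by linarith, by linarith, ?_⟩
    push_cast
    rw [Real.log_mul (by norm_num) (by linarith)]
    linarith
  · exact ⟨fun _ => 1, fun n _ => ⟨by norm_num, by norm_num, by norm_num⟩⟩

/-- If `a` is superadditive under doubling up to the defect of `h ≥ 0`, then `a n - h n` is at
most `n` times the limit of `a n / n`. -/
theorem le_limit_mul_add_of_doubling {a h : ℕ → ℝ} {γ : ℝ} {n₀ : ℕ} (hn₀ : 0 < n₀)
    (ha : Tendsto (fun n : ℕ => a n / n) atTop (nhds γ)) (hh : ∀ n, n₀ ≤ n → 0 ≤ h n)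
    (hdbl : ∀ n, n₀ ≤ n → 2 * (a n - h n) ≤ a (2 * n) - h (2 * n)) {n : ℕ} (hn : n₀ ≤ n) :
    a n ≤ γ * n + h n := by
  have hn' : (0 : ℝ) < n := by exact_mod_cast hn₀.trans_le hn
  have hle : ∀ j : ℕ, n₀ ≤ 2 ^ j * n := fun j =>
    hn.trans (Nat.le_mul_of_pos_left n (by positivity))
  have hiter : ∀ j : ℕ, 2 ^ j * (a n - h n) ≤ a (2 ^ j * n) - h (2 ^ j * n) := by
    intro j
    induction j with
    | zero => simp
    | succ j ih =>
      have := hdbl _ (hle j)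
      rw [pow_succ', pow_succ', mul_assoc, mul_assoc 2 (2 ^ j) n]
      linarith
  have htend : Tendsto (fun j : ℕ => a (2 ^ j * n) / ((2 ^ j * n : ℕ) : ℝ)) atTop (nhds γ) :=
    ha.comp ((tendsto_pow_atTop_atTop_of_one_lt one_lt_two).atTop_mul_const'
      (hn₀.trans_le hn))
  have hlim : (a n - h n) / n ≤ γ := by
    refine ge_of_tendsto' htend fun j => ?_
    push_cast
    rw [div_le_div_iff₀ hn' (by positivity)]
    have := hiter j
    have := hh _ (hle j)
    nlinarith
  rw [div_le_iff₀ hn'] at hlim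
  linarith

/-- For `d ≥ 5`, `|E[Cap(R_n)] - γ_d n| = O(ψ_d(n))` with `ψ_d(n) = √n` if `d = 5`,
`log n` if `d = 6`, and `1` if `d ≥ 7`, where `γ_d = lim E[Cap(R_n)]/n`. -/
theorem expCap_asymptotics {d : ℕ} (hd : 5 ≤ d) :
    ∃ γ C : ℝ, 0 < C ∧
      Tendsto (fun n : ℕ => expCapRange d n / n) atTop (nhds γ) ∧
      ∀ n : ℕ, 2 ≤ n →
        |expCapRange d n - γ * n| ≤
          C * (if d = 5 then Real.sqrt n else if d = 6 then Real.log n else 1) := by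
  have hsub : Subadditive (expCapRange d) := expCapRange_add_le (by omega)
  have hbdd : BddBelow (Set.range fun n : ℕ => expCapRange d n / n) :=
    ⟨0, by rintro _ ⟨n, rfl⟩; exact div_nonneg (expCapRange_nonneg n) n.cast_nonneg⟩
  have hlim := hsub.tendsto_lim hbdd
  obtain ⟨K, hK, hdbl⟩ := exists_two_mul_expCapRange_le hd
  obtain ⟨h, hh⟩ := exists_doubling_corrector d
  refine ⟨hsub.lim, 2 * K, by positivity, hlim, fun n hn => ?_⟩
  change _ ≤ 2 * K * errorOrder d n
  have hlower : hsub.lim * n ≤ expCapRange d n := by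
    have := hsub.lim_le_div hbdd (n := n) (by omega)
    rwa [le_div_iff₀ (by exact_mod_cast (show 0 < n by omega))] at this
  have hupper := le_limit_mul_add_of_doubling (h := fun n => K * h n) two_pos hlim
    (fun n hn => mul_nonneg hK.le (hh n hn).1) (fun n hn => by
      have h1 := hdbl n hn
      have h2 := mul_le_mul_of_nonneg_left (hh n hn).2.2 hK.le
      linarith) hn
  have hn2 := mul_le_mul_of_nonneg_left (hh n hn).2.1 hK.le
  rw [abs_of_nonneg (by linarith)]
  linarith

end SRW
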